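/- Let −∞ < a < b < ∞ and let f : (a,b) → ℝ be a definable function. Then there exist finitely many points a = t_0 < t_1 < … < t_k = b such that on each open interval (t_i, t_{i+1}) the function f is continuously differentiable and its derivative f' is either strictly positive at every point of the interval, or strictly negative at every point of the interval, or identically equal to zero on the interval. -/

import Mathlib

open Filter Metric Set Topology FirstOrder
open scoped ENNReal NNReal

noncomputable section

/-- The modulus of surjection `Sur F(x,y)(λ)`: the supremum of the radii `r ∈ [0,∞]`
such that the closed ball of radius `r` around `y` is contained in the image under `F`
of the closed ball of radius `lam` around `x` (with `sup ∅ = 0`). -/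
def surMod {X Y : Type*} [PseudoMetricSpace X] [PseudoMetricSpace Y]
    (F : X → Set Y) (x : X) (y : Y) (lam : ℝ) : ℝ≥0∞ :=
  sSup {r : ℝ≥0∞ | {v : Y | edist v y ≤ r} ⊆ ⋃ u ∈ Metric.closedBall x lam, F u}

/-- The rate of surjection `sur F(x̄|ȳ) = liminf_{(x,y,λ)→(x̄,ȳ,0+)} Sur F(x,y)(λ)/λ`. -/
def surRate {X Y : Type*} [PseudoMetricSpace X] [PseudoMetricSpace Y]
    (F : X → Set Y) (xb : X) (yb : Y) : ℝ≥0∞ :=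
  Filter.liminf
    (fun p : (X × Y) × ℝ => surMod F p.1.1 p.1.2 p.2 / ENNReal.ofReal p.2)
    ((𝓝 (xb, yb)) ×ˢ (𝓝[>] (0 : ℝ)))

/-- The graph of a set-valued mapping. -/
def svGraph {X Y : Type*} (F : X → Set Y) : Set (X × Y) := {p | p.2 ∈ F p.1}

/-- `y` is a critical value of `F` : there is `x` with `y ∈ F(x)` and `sur F(x|y) = 0`. -/
def IsCriticalValue {X Y : Type*} [PseudoMetricSpace X] [PseudoMetricSpace Y]
    (F : X → Set Y) (y : Y) : Prop :=
  ∃ x, y ∈ F x ∧ surRate F x y = 0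

/-- Definability (with parameters from `ℝ`) of a set of tuples. -/
def DefinableT (L : FirstOrder.Language) [L.Structure ℝ] {α : Type}
    (s : Set (α → ℝ)) : Prop :=
  (Set.univ : Set ℝ).Definable L s

/-- The o-minimality hypotheses: the order, addition and multiplication are definable and
every definable subset of `ℝ` is a finite union of points and open intervals. -/
structure IsOMinimalOn (L : FirstOrder.Language) [L.Structure ℝ] : Prop where
  definable_lt : DefinableT L {v : Fin 2 → ℝ | v 0 < v 1}
  definable_add : DefinableT L {v : Fin 3 → ℝ | v 2 = v 0 + v 1}
  definable_mul : DefinableT L {v : Fin 3 → ℝ | v 2 = v 0 * v 1}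
  finite_union : ∀ s : Set ℝ, DefinableT L {v : Fin 1 → ℝ | v 0 ∈ s} →
    ∃ (P : Finset ℝ) (I : Finset (EReal × EReal)),
      s = ↑P ∪ ⋃ p ∈ (I : Set (EReal × EReal)), {x : ℝ | p.1 < (x : EReal) ∧ (x : EReal) < p.2}

/-- Coding of a subset of `ℝⁿ × ℝᵐ` as a set of tuples. -/
def codeProd {n m : ℕ} (S : Set (EuclideanSpace ℝ (Fin n) × EuclideanSpace ℝ (Fin m))) :
    Set (Fin n ⊕ Fin m → ℝ) :=
  {v | ((WithLp.equiv 2 (Fin n → ℝ)).symm fun i => v (Sum.inl i),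
        (WithLp.equiv 2 (Fin m → ℝ)).symm fun j => v (Sum.inr j)) ∈ S}

/-- Coding of a subset of `ℝᵐ` as a set of tuples. -/
def codeE {m : ℕ} (S : Set (EuclideanSpace ℝ (Fin m))) : Set (Fin m → ℝ) :=
  {v | (WithLp.equiv 2 (Fin m → ℝ)).symm v ∈ S}

/-- A set of tuples is tame if its intersection with every bounded definable set is
definable. -/
def TameT (L : FirstOrder.Language) [L.Structure ℝ] {α : Type} [Fintype α]
    (s : Set (α → ℝ)) : Prop :=
  ∀ b : Set (α → ℝ), DefinableT L b → Bornology.IsBounded b → DefinableT L (s ∩ b)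

/-- A porous set in a metric space. -/
def Porous {X : Type*} [PseudoMetricSpace X] (Q : Set X) : Prop :=
  ∃ lam > (0 : ℝ), ∀ x ∈ Q, ∀ r > (0 : ℝ),
    ∃ z, Metric.ball z (lam * r) ⊆ Metric.ball x r \ Q

/-- A σ-porous set: a countable union of porous sets. -/
def SigmaPorous {X : Type*} [PseudoMetricSpace X] (Q : Set X) : Prop :=
  ∃ f : ℕ → Set X, (∀ i, Porous (f i)) ∧ Q = ⋃ i, f i

section Definability

variable {L : FirstOrder.Language} [L.Structure ℝ] {α β : Type}

/-- A function `(α → ℝ) → ℝ` is definable when its graph, coded in `Option α → ℝ` with the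
value at `none`, is definable. -/
def DefinableFn (L : FirstOrder.Language) [L.Structure ℝ] (g : (α → ℝ) → ℝ) : Prop :=
  DefinableT L {w : Option α → ℝ | w none = g fun i => w (some i)}

namespace DefinableT

theorem reindex {P : (α → ℝ) → Prop} (h : DefinableT L {v | P v}) (e : α → β) :
    DefinableT L {w : β → ℝ | P fun i => w (e i)} :=
  Set.Definable.preimage_comp e h

theorem not {P : (α → ℝ) → Prop} (h : DefinableT L {v | P v}) :
    DefinableT L {v | ¬ P v} :=
  Set.Definable.compl h

theorem and {P Q : (α → ℝ) → Prop} (hP : DefinableT L {v | P v})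
    (hQ : DefinableT L {v | Q v}) : DefinableT L {v | P v ∧ Q v} :=
  Set.Definable.inter hP hQ

theorem or {P Q : (α → ℝ) → Prop} (hP : DefinableT L {v | P v})
    (hQ : DefinableT L {v | Q v}) : DefinableT L {v | P v ∨ Q v} :=
  Set.Definable.union hP hQ

theorem imp {P Q : (α → ℝ) → Prop} (hP : DefinableT L {v | P v})
    (hQ : DefinableT L {v | Q v}) : DefinableT L {v | P v → Q v} := by
  simpa only [imp_iff_not_or] using hP.not.or hQ

theorem exists_real {P : ℝ → (α → ℝ) → Prop}
    (h : DefinableT L {w : Option α → ℝ | P (w none) fun i => w (some i)}) :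
    DefinableT L {v | ∃ x, P x v} := by
  have h' := Set.Definable.exists_of_finite (β := Unit)
    (h.reindex fun o : Option α => o.elim (Sum.inr ()) Sum.inl)
  refine (congrArg (DefinableT L) (Set.ext fun v => ?_)).mp h'
  exact ⟨fun ⟨u, hu⟩ => ⟨u (), hu⟩, fun ⟨x, hx⟩ => ⟨fun _ => x, hx⟩⟩

theorem forall_real {P : ℝ → (α → ℝ) → Prop}
    (h : DefinableT L {w : Option α → ℝ | P (w none) fun i => w (some i)}) :
    DefinableT L {v | ∀ x, P x v} := by
  have h' := (exists_real (P := fun x v => ¬ P x v) h.not).not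
  simpa only [not_exists, not_not] using h'

theorem coord_eq (i j : α) : DefinableT L {v : α → ℝ | v i = v j} :=
  ⟨(FirstOrder.Language.Term.var i).equal (FirstOrder.Language.Term.var j), by ext; simp⟩

theorem subst [Finite β] {P : (β → ℝ) → Prop} (h : DefinableT L {v | P v})
    {g : β → (α → ℝ) → ℝ} (hg : ∀ b, DefinableFn L (g b)) :
    DefinableT L {v | P fun b => g b v} := by
  have h₁ : DefinableT L
      {w : α ⊕ β → ℝ | ∀ b, w (Sum.inr b) = g b fun i => w (Sum.inl i)} := by
    have := Set.definable_iInter_of_finite fun b =>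
      (hg b).reindex fun o : Option α => o.elim (Sum.inr b) (Sum.inl : α → α ⊕ β)
    refine (congrArg (DefinableT L) (Set.ext fun v => ?_)).mp this
    simp
  have h' := Set.Definable.exists_of_finite (h₁.and (h.reindex Sum.inr))
  refine (congrArg (DefinableT L) (Set.ext fun v => ?_)).mp h'
  constructor
  · rintro ⟨u, hu, hP⟩
    have : u = fun b => g b v := funext hu
    simpa [this] using hP
  · exact fun hP => ⟨fun b => g b v, fun b => rfl, hP⟩

theorem eq {s t : (α → ℝ) → ℝ} (hs : DefinableFn L s) (ht : DefinableFn L t) :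
    DefinableT L {v | s v = t v} :=
  (coord_eq (0 : Fin 2) 1).subst (g := ![s, t]) (Fin.forall_fin_two.2 ⟨hs, ht⟩)

end DefinableT

namespace DefinableFn

theorem coord (i : α) : DefinableFn L fun v : α → ℝ => v i :=
  DefinableT.coord_eq none (some i)

theorem const (c : ℝ) : DefinableFn L fun _ : α → ℝ => c :=
  DefinableT.reindex (P := fun v : Fin 1 → ℝ => v 0 = c)
    (Set.Definable.singleton_of_mem L (Set.mem_univ c)) fun _ => none

theorem lift {t : (α → ℝ) → ℝ} (ht : DefinableFn L t) :
    DefinableFn L fun w : Option α → ℝ => t fun i => w (some i) :=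
  DefinableT.reindex ht fun o => o.elim none fun i => some (some i)

theorem comp [Finite β] {F : (β → ℝ) → ℝ} (hF : DefinableFn L F) {g : β → (α → ℝ) → ℝ}
    (hg : ∀ b, DefinableFn L (g b)) : DefinableFn L fun v => F fun b => g b v :=
  DefinableT.subst hF (g := fun o (w : Option α → ℝ) =>
    o.elim (w none) fun b => g b fun i => w (some i))
    (Option.rec (coord none) fun b => (hg b).lift)

theorem apply {F : ℝ → ℝ} (hF : DefinableFn L fun v : Fin 1 → ℝ => F (v 0))
    {t : (α → ℝ) → ℝ} (ht : DefinableFn L t) : DefinableFn L fun v => F (t v) :=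
  hF.comp (g := fun _ => t) fun _ => ht

end DefinableFn

namespace IsOMinimalOn

theorem lt (hL : IsOMinimalOn L) {s t : (α → ℝ) → ℝ} (hs : DefinableFn L s)
    (ht : DefinableFn L t) : DefinableT L {v | s v < t v} :=
  DefinableT.subst (P := fun v : Fin 2 → ℝ => v 0 < v 1) hL.definable_lt (g := ![s, t])
    (Fin.forall_fin_two.2 ⟨hs, ht⟩)

theorem le (hL : IsOMinimalOn L) {s t : (α → ℝ) → ℝ} (hs : DefinableFn L s)
    (ht : DefinableFn L t) : DefinableT L {v | s v ≤ t v} := by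
  simpa only [not_lt] using (hL.lt ht hs).not

theorem add (hL : IsOMinimalOn L) {s t : (α → ℝ) → ℝ} (hs : DefinableFn L s)
    (ht : DefinableFn L t) : DefinableFn L fun v => s v + t v :=
  DefinableT.subst (P := fun v : Fin 3 → ℝ => v 2 = v 0 + v 1) hL.definable_add
    (g := ![fun w : Option α → ℝ => s fun i => w (some i), fun w => t fun i => w (some i),
      fun w => w none])
    (Fin.forall_fin_succ.2 ⟨hs.lift, Fin.forall_fin_two.2 ⟨ht.lift, .coord none⟩⟩)

theorem mul (hL : IsOMinimalOn L) {s t : (α → ℝ) → ℝ} (hs : DefinableFn L s)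
    (ht : DefinableFn L t) : DefinableFn L fun v => s v * t v :=
  DefinableT.subst (P := fun v : Fin 3 → ℝ => v 2 = v 0 * v 1) hL.definable_mul
    (g := ![fun w : Option α → ℝ => s fun i => w (some i), fun w => t fun i => w (some i),
      fun w => w none])
    (Fin.forall_fin_succ.2 ⟨hs.lift, Fin.forall_fin_two.2 ⟨ht.lift, .coord none⟩⟩)

theorem sub (hL : IsOMinimalOn L) {s t : (α → ℝ) → ℝ} (hs : DefinableFn L s)
    (ht : DefinableFn L t) : DefinableFn L fun v => s v - t v := by
  have h := DefinableT.eq (hL.add (.coord none) ht.lift) hs.lift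
  simpa only [DefinableFn, eq_sub_iff_add_eq] using h

/-- Off a finite set, a definable subset of the line is locally constant. -/
theorem exists_finite_forall_Ioo (hL : IsOMinimalOn L) {S : Set ℝ}
    (hS : DefinableT L {v : Fin 1 → ℝ | v 0 ∈ S}) :
    ∃ T : Set ℝ, T.Finite ∧
      ∀ u v, Disjoint (Ioo u v) T → Ioo u v ⊆ S ∨ Disjoint (Ioo u v) S := by
  obtain ⟨P, I, rfl⟩ := hL.finite_union S hS
  refine ⟨↑P ∪ ((fun p : EReal × EReal => p.1.toReal) '' I ∪
    (fun p : EReal × EReal => p.2.toReal) '' I),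
    P.finite_toSet.union ((I.finite_toSet.image _).union (I.finite_toSet.image _)), ?_⟩
  intro u v huv
  rw [Set.disjoint_left] at huv
  refine or_iff_not_imp_right.2 fun hmeet y hy => ?_
  obtain ⟨x, hx, hxS⟩ := Set.not_disjoint_iff.1 hmeet
  obtain hxP | hxI := hxS
  · exact absurd (Or.inl hxP) (huv hx)
  · simp only [mem_iUnion] at hxI
    obtain ⟨p, hp, hpx, hxp⟩ := hxI
    refine Or.inr (mem_iUnion₂.2 ⟨p, hp, ?_, ?_⟩)
    · by_contra! hle
      obtain ⟨r, hr⟩ : ∃ r : ℝ, (r : EReal) = p.1 :=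
        ⟨p.1.toReal, EReal.coe_toReal (hpx.trans (EReal.coe_lt_top x)).ne
          ((EReal.bot_lt_coe y).trans_le hle).ne'⟩
      rw [← hr, EReal.coe_lt_coe_iff] at hpx
      rw [← hr, EReal.coe_le_coe_iff] at hle
      exact huv (a := r) ⟨hy.1.trans_le hle, hpx.trans hx.2⟩
        (Or.inr (Or.inl ⟨p, hp, by simp [← hr]⟩))
    · by_contra! hle
      obtain ⟨r, hr⟩ : ∃ r : ℝ, (r : EReal) = p.2 :=
        ⟨p.2.toReal, EReal.coe_toReal (hle.trans_lt (EReal.coe_lt_top y)).ne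
          ((EReal.bot_lt_coe x).trans hxp).ne'⟩
      rw [← hr, EReal.coe_lt_coe_iff] at hxp
      rw [← hr, EReal.coe_le_coe_iff] at hle
      exact huv (a := r) ⟨hx.1.trans hxp, hle.trans_lt hy.2⟩
        (Or.inr (Or.inr ⟨p, hp, by simp [← hr]⟩))

theorem exists_Ioo_subset_of_infinite (hL : IsOMinimalOn L) {S : Set ℝ}
    (hS : DefinableT L {v : Fin 1 → ℝ | v 0 ∈ S}) (hinf : S.Infinite) :
    ∃ c d, c < d ∧ Ioo c d ⊆ S := by
  obtain ⟨T, hT, h⟩ := hL.exists_finite_forall_Ioo hS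
  obtain ⟨x, hxS, hxT⟩ := (hinf.sdiff hT).nonempty
  obtain ⟨c, d, hx, hcd⟩ := mem_nhds_iff_exists_Ioo_subset.1 (hT.isClosed.compl_mem_nhds hxT)
  refine ⟨c, d, hx.1.trans hx.2, (h c d ?_).resolve_right ?_⟩
  · exact Set.disjoint_left.2 hcd
  · exact Set.not_disjoint_iff.2 ⟨x, hx, hxS⟩

theorem eventually_nhdsGT_or (hL : IsOMinimalOn L) {S : Set ℝ}
    (hS : DefinableT L {v : Fin 1 → ℝ | v 0 ∈ S}) (x : ℝ) :
    (∀ᶠ y in 𝓝[>] x, y ∈ S) ∨ ∀ᶠ y in 𝓝[>] x, y ∉ S := by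
  obtain ⟨T, hT, h⟩ := hL.exists_finite_forall_Ioo hS
  have hev : (T \ {x})ᶜ ∈ 𝓝 x := hT.sdiff.isClosed.compl_mem_nhds (by simp)
  obtain ⟨c, d, hx, hcd⟩ := mem_nhds_iff_exists_Ioo_subset.1 hev
  have hmem : Ioo x d ∈ 𝓝[>] x := Ioo_mem_nhdsGT hx.2
  refine (h x d (Set.disjoint_left.2 fun y hy hyT => ?_)).imp (mem_of_superset hmem)
    fun hdisj => mem_of_superset hmem (Set.disjoint_left.1 hdisj)
  exact hcd ⟨hx.1.trans hy.1, hy.2⟩ ⟨hyT, hy.1.ne'⟩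

/-- Some member of a countable definable cover of an open interval contains an open interval. -/
theorem exists_Ioo_subset_of_subset_iUnion (hL : IsOMinimalOn L) {ι : Type*} [Countable ι]
    {S : ι → Set ℝ} (hS : ∀ i, DefinableT L {v : Fin 1 → ℝ | v 0 ∈ S i}) {c d : ℝ}
    (hcd : c < d) (hcover : Ioo c d ⊆ ⋃ i, S i) :
    ∃ i u v, u < v ∧ Ioo u v ⊆ Ioo c d ∩ S i := by
  have hunc : ¬ (⋃ i, Ioo c d ∩ S i).Countable := by
    rw [← inter_iUnion, inter_eq_left.2 hcover, Cardinal.Real.Ioo_countable_iff]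
    exact hcd.not_ge
  obtain ⟨i, hi⟩ : ∃ i, ¬ (Ioo c d ∩ S i).Countable := by
    by_contra! h
    exact hunc (countable_iUnion h)
  have hdef : DefinableT L {v : Fin 1 → ℝ | v 0 ∈ Ioo c d ∩ S i} :=
    ((hL.lt (.const c) (.coord 0)).and (hL.lt (.coord 0) (.const d))).and (hS i)
  exact ⟨i, hL.exists_Ioo_subset_of_infinite hdef fun hfin => hi hfin.countable⟩

/-- A definable function is weakly monotone on some subinterval of any open interval. -/
theorem exists_Ioo_monotoneOn_or_antitoneOn (hL : IsOMinimalOn L) {F : ℝ → ℝ}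
    (hF : DefinableFn L fun v : Fin 1 → ℝ => F (v 0)) {c d : ℝ} (hcd : c < d) :
    ∃ u v, u < v ∧ Ioo u v ⊆ Ioo c d ∧
      (MonotoneOn F (Ioo u v) ∨ AntitoneOn F (Ioo u v)) := by
  let R : Bool → ℝ → ℝ → Prop := fun σ y z => cond σ (F y ≤ F z) (F z < F y)
  let S : Bool × ℚ → Set ℝ := fun i => {x | x < i.2 ∧ ∀ y, x < y ∧ y < i.2 → R i.1 x y}
  have hR : ∀ (σ : Bool) {α : Type} {s t : (α → ℝ) → ℝ}, DefinableFn L s → DefinableFn L t →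
      DefinableT L {v | R σ (s v) (t v)} := fun σ α s t hs ht => by
    cases σ
    · exact hL.lt (hF.apply ht) (hF.apply hs)
    · exact hL.le (hF.apply hs) (hF.apply ht)
  have hS : ∀ i, DefinableT L {v : Fin 1 → ℝ | v 0 ∈ S i} := fun i =>
    (hL.lt (.coord 0) (.const _)).and (DefinableT.forall_real
      (P := fun y v => v 0 < y ∧ y < i.2 → R i.1 (v 0) y)
      (((hL.lt (.coord (some 0)) (.coord none)).and (hL.lt (.coord none) (.const _))).imp
        (hR i.1 (.coord (some 0)) (.coord none))))
  have hcover : Ioo c d ⊆ ⋃ i, S i := by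
    intro x _
    obtain ⟨σ, hσ⟩ : ∃ σ, ∀ᶠ y in 𝓝[>] x, R σ x y := by
      have hdef : DefinableT L {v : Fin 1 → ℝ | v 0 ∈ {y | R true x y}} :=
        hR true (.const x) (.coord 0)
      obtain h | h := hL.eventually_nhdsGT_or hdef x
      · exact ⟨true, h⟩
      · exact ⟨false, h.mono fun y hy => not_le.1 hy⟩
    obtain ⟨z, hz, hsub⟩ := mem_nhdsGT_iff_exists_Ioo_subset.1 hσ
    obtain ⟨q, hxq, hqz⟩ := exists_rat_btwn (show x < z from hz)
    exact mem_iUnion.2 ⟨(σ, q), hxq, fun y hy => hsub ⟨hy.1, hy.2.trans hqz⟩⟩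
  obtain ⟨⟨σ, q⟩, u, v, huv, hsub⟩ := hL.exists_Ioo_subset_of_subset_iUnion hS hcd hcover
  have hRσ : ∀ x ∈ Ioo u v, ∀ y ∈ Ioo u v, x < y → R σ x y := fun x hx y hy hxy =>
    (hsub hx).2.2 y ⟨hxy, (hsub hy).2.1⟩
  refine ⟨u, v, huv, fun x hx => (hsub hx).1, ?_⟩
  cases σ
  · refine Or.inr fun x hx y hy hxy => ?_
    obtain rfl | hlt := hxy.eq_or_lt
    exacts [le_rfl, (hRσ x hx y hy hlt).le]
  · refine Or.inl fun x hx y hy hxy => ?_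
    obtain rfl | hlt := hxy.eq_or_lt
    exacts [le_rfl, hRσ x hx y hy hlt]

end IsOMinimalOn

theorem hasDerivAt_iff_forall_sq_le {F : ℝ → ℝ} {l x : ℝ} :
    HasDerivAt F l x ↔ ∀ ε, 0 < ε → ∃ δ, 0 < δ ∧ ∀ y, y - x < δ ∧ x - y < δ →
      (F y - F x - (y - x) * l) * (F y - F x - (y - x) * l) ≤
        (ε * (y - x)) * (ε * (y - x)) := by
  rw [hasDerivAt_iff_isLittleO, Asymptotics.isLittleO_iff]
  refine forall₂_congr fun ε hε => ?_
  rw [Metric.eventually_nhds_iff]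
  refine exists_congr fun δ => and_congr_right fun _ => forall_congr' fun y => ?_
  rw [Real.dist_eq, abs_lt, neg_lt, neg_sub, and_comm]
  refine imp_congr_right fun _ => ?_
  rw [← abs_le_iff_mul_self_le, abs_mul, abs_of_pos hε]
  rfl

namespace IsOMinimalOn

theorem hasDerivAt (hL : IsOMinimalOn L) {F : ℝ → ℝ}
    (hF : DefinableFn L fun v : Fin 1 → ℝ => F (v 0)) {s t : (α → ℝ) → ℝ}
    (hs : DefinableFn L s) (ht : DefinableFn L t) :
    DefinableT L {v | HasDerivAt F (s v) (t v)} := by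
  simp only [hasDerivAt_iff_forall_sq_le]
  refine DefinableT.forall_real ((hL.lt (.const 0) (.coord none)).imp (DefinableT.exists_real
    ((hL.lt (.const 0) (.coord none)).and (DefinableT.forall_real (DefinableT.imp ?_ ?_)))))
  · exact (hL.lt (hL.sub (.coord none) ht.lift.lift.lift) (.coord (some none))).and
      (hL.lt (hL.sub ht.lift.lift.lift (.coord none)) (.coord (some none)))
  · have hy := hL.sub (.coord none) ht.lift.lift.lift
    have hr := hL.sub (hL.sub (hF.apply (.coord none)) (hF.apply ht.lift.lift.lift))
      (hL.mul hy hs.lift.lift.lift)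
    have he := hL.mul (.coord (some (some none))) hy
    exact hL.le (hL.mul hr hr) (hL.mul he he)

theorem differentiableAt (hL : IsOMinimalOn L) {F : ℝ → ℝ}
    (hF : DefinableFn L fun v : Fin 1 → ℝ => F (v 0)) {t : (α → ℝ) → ℝ}
    (ht : DefinableFn L t) : DefinableT L {v | DifferentiableAt ℝ F (t v)} := by
  have h := DefinableT.exists_real (P := fun l v => HasDerivAt F l (t v))
    (hL.hasDerivAt hF (.coord none) ht.lift)
  refine (congrArg (DefinableT L) (Set.ext fun v => ?_)).mp h
  exact ⟨fun ⟨l, hl⟩ => hl.differentiableAt, fun hd => ⟨_, hd.hasDerivAt⟩⟩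

theorem deriv (hL : IsOMinimalOn L) {F : ℝ → ℝ}
    (hF : DefinableFn L fun v : Fin 1 → ℝ => F (v 0)) :
    DefinableFn L fun v : Fin 1 → ℝ => deriv F (v 0) := by
  have h := (hL.hasDerivAt (α := Option (Fin 1)) hF (.coord none) (.coord (some 0))).or
    ((hL.differentiableAt hF (.coord (some 0))).not.and
      (DefinableT.eq (.coord none) (.const 0)))
  refine (congrArg (DefinableT L) (Set.ext fun w => ?_)).mp h
  constructor
  · rintro (hd | ⟨hd, h0⟩)
    · exact hd.deriv.symm
    · exact h0.trans (deriv_zero_of_not_differentiableAt hd).symm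
  · intro hw
    by_cases hd : DifferentiableAt ℝ F (w (some 0))
    · left
      have : w none = _root_.deriv F (w (some 0)) := hw
      simpa only [mem_ofPred_eq, this] using hd.hasDerivAt
    · exact Or.inr ⟨hd, Eq.trans hw (deriv_zero_of_not_differentiableAt hd)⟩

/-- By Lebesgue's theorem on monotone functions, a definable function is differentiable off a
finite set. -/
theorem finite_not_differentiableAt (hL : IsOMinimalOn L) {F : ℝ → ℝ}
    (hF : DefinableFn L fun v : Fin 1 → ℝ => F (v 0)) :
    {x | ¬ DifferentiableAt ℝ F x}.Finite := by
  by_contra hinf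
  obtain ⟨c, d, hcd, hsub⟩ :=
    hL.exists_Ioo_subset_of_infinite (hL.differentiableAt hF (.coord 0)).not hinf
  obtain ⟨u, v, huv, huvcd, hmono⟩ := hL.exists_Ioo_monotoneOn_or_antitoneOn hF hcd
  have hae : ∀ᵐ x, x ∈ Ioo u v → DifferentiableWithinAt ℝ F (Ioo u v) x := by
    obtain h | h := hmono
    · exact h.ae_differentiableWithinAt_of_mem
    · filter_upwards [h.neg.ae_differentiableWithinAt_of_mem] with x hx hxm
      simpa using (hx hxm).neg
  have hnull : MeasureTheory.volume (Ioo u v) = 0 := by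
    refine MeasureTheory.measure_mono_null (fun x hx => ?_) (MeasureTheory.ae_iff.1 hae)
    exact fun hx' => hsub (huvcd hx) ((hx' hx).differentiableAt (isOpen_Ioo.mem_nhds hx))
  rw [Real.volume_Ioo, ENNReal.ofReal_eq_zero] at hnull
  linarith

end IsOMinimalOn

end Definability

/-- A finite set cuts `(a, b)` into finitely many consecutive open intervals missing it. -/
theorem exists_partition_disjoint_finite {a b : ℝ} (hab : a < b) {B : Set ℝ} (hB : B.Finite) :
    ∃ (k : ℕ) (t : Fin (k + 1) → ℝ),
      StrictMono t ∧ t 0 = a ∧ t (Fin.last k) = b ∧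
      ∀ i : Fin k, Disjoint (Ioo (t i.castSucc) (t i.succ)) B := by
  let T : Finset ℝ := insert a (insert b (hB.toFinset.filter fun x => x ∈ Icc a b))
  have hT : ∀ x, x ∈ T ↔ x = a ∨ x = b ∨ x ∈ B ∧ x ∈ Icc a b := by simp [T]
  have hTab : ∀ x ∈ T, x ∈ Icc a b := by
    intro x hx
    obtain rfl | rfl | h := (hT x).1 hx
    exacts [⟨le_rfl, hab.le⟩, ⟨hab.le, le_rfl⟩, h.2]
  have haT : a ∈ T := (hT a).2 (Or.inl rfl)
  have hbT : b ∈ T := (hT b).2 (Or.inr (Or.inl rfl))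
  obtain ⟨k, hk⟩ : ∃ k, T.card = k + 1 :=
    Nat.exists_eq_succ_of_ne_zero (Finset.card_pos.2 ⟨a, haT⟩).ne'
  let t := T.orderEmbOfFin hk
  have ht : ∀ x ∈ T, ∃ j, t j = x := fun x hx => by
    rwa [← Finset.mem_coe, ← T.range_orderEmbOfFin hk] at hx
  have htT : ∀ j, t j ∈ Icc a b := fun j => hTab _ (T.orderEmbOfFin_mem hk j)
  have h0 : t 0 = a := by
    obtain ⟨j, hj⟩ := ht a haT
    exact le_antisymm (hj ▸ t.monotone (Fin.zero_le j)) (htT 0).1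
  have h1 : t (Fin.last k) = b := by
    obtain ⟨j, hj⟩ := ht b hbT
    exact le_antisymm (htT _).2 (hj ▸ t.monotone (Fin.le_last j))
  refine ⟨k, t, t.strictMono, h0, h1, fun i => Set.disjoint_left.2 fun x hx hxB => ?_⟩
  obtain ⟨j, rfl⟩ := ht x ((hT x).2 (Or.inr (Or.inr
    ⟨hxB, (htT _).1.trans hx.1.le, hx.2.le.trans (htT _).2⟩)))
  have hlo := t.lt_iff_lt.1 hx.1
  have hhi := t.lt_iff_lt.1 hx.2
  simp only [Fin.lt_def, Fin.val_castSucc, Fin.val_succ] at hlo hhi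
  omega

/-- **Corollary of Proposition 4.** For a definable function `f` on a bounded interval
`(a,b)` there are finitely many points `a = t₀ < t₁ < … < t_k = b` such that on each
`(tᵢ, tᵢ₊₁)` the function `f` is continuously differentiable with derivative either
everywhere strictly positive, or everywhere strictly negative, or identically zero. -/
theorem definable_piecewise_monotone_C1
    (L : FirstOrder.Language) [L.Structure ℝ] (hL : IsOMinimalOn L)
    (a b : ℝ) (hab : a < b) (f : ℝ → ℝ)
    (hfdef : DefinableT L {v : Fin 2 → ℝ | v 0 ∈ Set.Ioo a b ∧ v 1 = f (v 0)}) :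
    ∃ (k : ℕ) (t : Fin (k + 1) → ℝ),
      StrictMono t ∧ t 0 = a ∧ t (Fin.last k) = b ∧
      ∀ i : Fin k,
        (∀ x ∈ Set.Ioo (t i.castSucc) (t i.succ), DifferentiableAt ℝ f x) ∧
        ContinuousOn (deriv f) (Set.Ioo (t i.castSucc) (t i.succ)) ∧
        ((∀ x ∈ Set.Ioo (t i.castSucc) (t i.succ), 0 < deriv f x) ∨
         (∀ x ∈ Set.Ioo (t i.castSucc) (t i.succ), deriv f x < 0) ∨
         (∀ x ∈ Set.Ioo (t i.castSucc) (t i.succ), deriv f x = 0)) := by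
  let F : ℝ → ℝ := fun x => if x ∈ Ioo a b then f x else 0
  have hF : DefinableFn L fun v : Fin 1 → ℝ => F (v 0) := by
    have h₁ := hfdef.reindex ![some (0 : Fin 1), none]
    have hI : DefinableT L {w : Option (Fin 1) → ℝ | w (some 0) ∈ Ioo a b} :=
      (hL.lt (.const a) (.coord _)).and (hL.lt (.coord _) (.const b))
    have h := h₁.or (hI.not.and (DefinableT.eq (.coord none) (.const 0)))
    refine (congrArg (DefinableT L) (Set.ext fun w => ?_)).mp h
    change (w (some 0) ∈ Ioo a b ∧ w none = f (w (some 0))) ∨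
        (w (some 0) ∉ Ioo a b ∧ w none = 0) ↔
      w none = if w (some 0) ∈ Ioo a b then f (w (some 0)) else 0
    split_ifs <;> tauto
  have hF' := hL.deriv hF
  obtain ⟨Tp, hTp, hpos⟩ := hL.exists_finite_forall_Ioo (S := {x | 0 < deriv F x})
    (hL.lt (.const 0) hF')
  obtain ⟨Tn, hTn, hneg⟩ := hL.exists_finite_forall_Ioo (S := {x | deriv F x < 0})
    (hL.lt hF' (.const 0))
  obtain ⟨k, t, hmono, h0, h1, hdisj⟩ := exists_partition_disjoint_finite hab
    ((hL.finite_not_differentiableAt hF).union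
      ((hL.finite_not_differentiableAt hF').union (hTp.union hTn)))
  refine ⟨k, t, hmono, h0, h1, fun i => ?_⟩
  have hd := hdisj i
  simp only [Set.disjoint_union_right] at hd
  obtain ⟨hdF, hdF', hdp, hdn⟩ := hd
  have hsub : Ioo (t i.castSucc) (t i.succ) ⊆ Ioo a b :=
    Ioo_subset_Ioo (h0 ▸ hmono.monotone (Fin.zero_le _)) (h1 ▸ hmono.monotone (Fin.le_last _))
  have hfF : ∀ x ∈ Ioo (t i.castSucc) (t i.succ), f =ᶠ[𝓝 x] F := fun x hx => by
    filter_upwards [isOpen_Ioo.mem_nhds (hsub hx)] with y hy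
    exact (if_pos hy).symm
  have hderiv : EqOn (deriv f) (deriv F) (Ioo (t i.castSucc) (t i.succ)) :=
    fun x hx => (hfF x hx).deriv_eq
  refine ⟨fun x hx => ?_, ?_, ?_⟩
  · exact (hfF x hx).differentiableAt_iff.2 (not_not.1 (Set.disjoint_left.1 hdF hx))
  · refine ContinuousOn.congr (fun x hx => ?_) hderiv
    exact (not_not.1 (Set.disjoint_left.1 hdF' hx)).continuousAt.continuousWithinAt
  · obtain hp | hp := hpos _ _ hdp
    · exact Or.inl fun x hx => hderiv hx ▸ hp hx
    obtain hn | hn := hneg _ _ hdn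
    · exact Or.inr (Or.inl fun x hx => hderiv hx ▸ hn hx)
    refine Or.inr (Or.inr fun x hx => (hderiv hx).trans (le_antisymm ?_ ?_))
    · exact not_lt.1 (Set.disjoint_left.1 hp hx)
    · exact not_lt.1 (Set.disjoint_left.1 hn hx)
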